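/- arXiv:1105.1574 — 4 statements merged into one kernel-verified Lean document; each statement's English description precedes it below -/
import Mathlib

section
/- With the notation of the closed-loop matrices 𝒜 := [[A, Ec],[eC, a]], ℬ := [[B, Ed],[eD, b]], Θ₀ := diag(K₁, K₂), J := diag(J₁, J₂), where K₁, K₂, J₁, J₂ are antisymmetric, suppose the plant physical realizability conditions hold: A K₁ + K₁ Aᵀ + B J₁ Bᵀ + E d J₂ dᵀ Eᵀ = 0 and C K₁ + D J₁ Bᵀ = 0, and suppose the matrix E ∈ ℝ^{n×p₂} has full column rank (i.e., Eᵀ E is invertible). Then 𝒜Θ₀ + Θ₀𝒜ᵀ + ℬJℬᵀ = 0 holds if and only if the controller physical realizability conditions hold: a K₂ + K₂ aᵀ + e D J₁ Dᵀ eᵀ + b J₂ bᵀ = 0 and c K₂ + d J₂ bᵀ = 0. -/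
open Matrix

theorem stmt_1 (n m₁ m₂ p₁ p₂ : ℕ) (hn : 0 < n) (hm₁ : 0 < m₁) (hm₂ : 0 < m₂)
    (hp₁ : 0 < p₁) (hp₂ : 0 < p₂)
    (A : Matrix (Fin n) (Fin n) ℝ) (B : Matrix (Fin n) (Fin m₁) ℝ)
    (C : Matrix (Fin p₁) (Fin n) ℝ) (D : Matrix (Fin p₁) (Fin m₁) ℝ)
    (E : Matrix (Fin n) (Fin p₂) ℝ)
    (a : Matrix (Fin n) (Fin n) ℝ) (b : Matrix (Fin n) (Fin m₂) ℝ)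
    (c : Matrix (Fin p₂) (Fin n) ℝ) (d : Matrix (Fin p₂) (Fin m₂) ℝ)
    (e : Matrix (Fin n) (Fin p₁) ℝ)
    (K₁ K₂ : Matrix (Fin n) (Fin n) ℝ) (hK₁ : K₁ᵀ = -K₁) (hK₂ : K₂ᵀ = -K₂)
    (J₁ : Matrix (Fin m₁) (Fin m₁) ℝ) (hJ₁ : J₁ᵀ = -J₁)
    (J₂ : Matrix (Fin m₂) (Fin m₂) ℝ) (hJ₂ : J₂ᵀ = -J₂)
    -- plant physical realizability conditions
    (hPR1 : A * K₁ + K₁ * Aᵀ + B * J₁ * Bᵀ + E * d * J₂ * dᵀ * Eᵀ = 0)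
    (hPR2 : C * K₁ + D * J₁ * Bᵀ = 0)
    -- E has full column rank
    (hE : IsUnit (Eᵀ * E))
    (𝒜 : Matrix (Fin n ⊕ Fin n) (Fin n ⊕ Fin n) ℝ)
    (ℬ : Matrix (Fin n ⊕ Fin n) (Fin m₁ ⊕ Fin m₂) ℝ)
    (Θ₀ : Matrix (Fin n ⊕ Fin n) (Fin n ⊕ Fin n) ℝ)
    (J : Matrix (Fin m₁ ⊕ Fin m₂) (Fin m₁ ⊕ Fin m₂) ℝ)
    (h𝒜 : 𝒜 = fromBlocks A (E * c) (e * C) a)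
    (hℬ : ℬ = fromBlocks B (E * d) (e * D) b)
    (hΘ₀ : Θ₀ = fromBlocks K₁ 0 0 K₂)
    (hJ : J = fromBlocks J₁ 0 0 J₂) :
    𝒜 * Θ₀ + Θ₀ * 𝒜ᵀ + ℬ * J * ℬᵀ = 0 ↔
      (a * K₂ + K₂ * aᵀ + e * D * J₁ * Dᵀ * eᵀ + b * J₂ * bᵀ = 0 ∧
       c * K₂ + d * J₂ * bᵀ = 0) := by
  subst h𝒜 hℬ hΘ₀ hJ
  have hPR2t : K₁ * Cᵀ + B * J₁ * Dᵀ = 0 := by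
    have h := congrArg Matrix.transpose hPR2
    simp only [transpose_add, transpose_mul, transpose_transpose, hK₁, hJ₁, transpose_zero,
      Matrix.neg_mul, Matrix.mul_neg] at h
    rw [← neg_add, neg_eq_zero, ← Matrix.mul_assoc] at h
    exact h
  have h₁₂ : E * c * K₂ + K₁ * (e * C)ᵀ + (B * J₁ * (e * D)ᵀ + E * d * J₂ * bᵀ) =
      E * (c * K₂ + d * J₂ * bᵀ) := by
    have h : K₁ * (e * C)ᵀ + B * J₁ * (e * D)ᵀ = 0 := by
      rw [transpose_mul, transpose_mul, ← Matrix.mul_assoc, ← Matrix.mul_assoc,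
        ← Matrix.add_mul, hPR2t, Matrix.zero_mul]
    rw [add_comm (E * c * K₂), add_add_add_comm, h, zero_add]
    simp only [Matrix.mul_add, Matrix.mul_assoc]
  have h₂₁ : e * C * K₁ + K₂ * (E * c)ᵀ + (e * D * J₁ * Bᵀ + b * J₂ * (E * d)ᵀ) =
      -(E * (c * K₂ + d * J₂ * bᵀ))ᵀ := by
    have h : e * C * K₁ + e * D * J₁ * Bᵀ = 0 := by
      rw [Matrix.mul_assoc, Matrix.mul_assoc e, Matrix.mul_assoc e, ← Matrix.mul_add, hPR2,
        Matrix.mul_zero]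
    rw [add_add_add_comm, h, zero_add]
    simp only [transpose_add, transpose_mul, transpose_transpose, hK₂, hJ₂, Matrix.add_mul,
      Matrix.neg_mul, Matrix.mul_neg, neg_add, neg_neg, Matrix.mul_assoc]
  have h₁₁ : A * K₁ + K₁ * Aᵀ + (B * J₁ * Bᵀ + E * d * J₂ * (E * d)ᵀ) = 0 := by
    rw [transpose_mul, ← Matrix.mul_assoc, ← add_assoc, hPR1]
  have h₂₂ : a * K₂ + K₂ * aᵀ + (e * D * J₁ * (e * D)ᵀ + b * J₂ * bᵀ) =
      a * K₂ + K₂ * aᵀ + e * D * J₁ * Dᵀ * eᵀ + b * J₂ * bᵀ := by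
    rw [transpose_mul, ← Matrix.mul_assoc, ← add_assoc]
  simp only [fromBlocks_transpose, fromBlocks_multiply, fromBlocks_add, Matrix.mul_zero,
    Matrix.zero_mul, add_zero, zero_add]
  rw [h₁₁, h₁₂, h₂₁, h₂₂, ← fromBlocks_zero, fromBlocks_inj]
  constructor
  · rintro ⟨-, h, -, h'⟩
    refine ⟨h', ?_⟩
    rw [← Matrix.nonsing_inv_mul_cancel_left (Eᵀ * E) (c * K₂ + d * J₂ * bᵀ)
      ((isUnit_iff_isUnit_det _).mp hE), Matrix.mul_assoc Eᵀ, h, Matrix.mul_zero, Matrix.mul_zero]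
  · rintro ⟨h', h⟩
    simp [h, h']
end

section
/- Let n = 2ν be even and J₀ := I_ν ⊗ [[0,1],[-1,0]] the canonical antisymmetric matrix of order n. Let Γ ∈ ℝ^{n×n} be antisymmetric. Then a matrix a ∈ ℝ^{n×n} satisfies the linear equation a J₀ + J₀ aᵀ + Γ = 0 if and only if there exists a real symmetric matrix R of order n such that a = Γ J₀ / 2 + J₀ R. -/
open Matrix
open scoped Kronecker

/-- The canonical antisymmetric matrix `J₀ = I_ν ⊗ [[0,1],[-1,0]]` of (even) order `n = 2ν`. -/
noncomputable def J0 (ν : ℕ) : Matrix (Fin ν × Fin 2) (Fin ν × Fin 2) ℝ :=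
  (1 : Matrix (Fin ν) (Fin ν) ℝ) ⊗ₖ !![(0 : ℝ), 1; -1, 0]

theorem J0_transpose (ν : ℕ) : (J0 ν)ᵀ = -J0 ν := by
  ext ⟨i, k⟩ ⟨j, l⟩
  fin_cases k <;> fin_cases l <;> simp [J0, Matrix.one_apply, eq_comm]

theorem J0_mul_self (ν : ℕ) : J0 ν * J0 ν = -1 := by
  have h : !![(0 : ℝ), 1; -1, 0] * !![(0 : ℝ), 1; -1, 0] = (-1 : ℝ) • 1 := by
    ext i j
    fin_cases i <;> fin_cases j <;> simp
  rw [J0, ← Matrix.mul_kronecker_mul, h, Matrix.kronecker_smul]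
  simp

theorem stmt_2 (ν : ℕ) (Γ a : Matrix (Fin ν × Fin 2) (Fin ν × Fin 2) ℝ)
    (hΓ : Γᵀ = -Γ) :
    a * J0 ν + J0 ν * aᵀ + Γ = 0 ↔
      ∃ R : Matrix (Fin ν × Fin 2) (Fin ν × Fin 2) ℝ,
        Rᵀ = R ∧ a = (1 / 2 : ℝ) • (Γ * J0 ν) + J0 ν * R := by
  have hJt := J0_transpose ν
  have hJJ := J0_mul_self ν
  generalize J0 ν = J at hJt hJJ ⊢
  have hJJ_mul (M : Matrix (Fin ν × Fin 2) (Fin ν × Fin 2) ℝ) : J * (J * M) = -M := by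
    rw [← mul_assoc, hJJ, neg_one_mul]
  constructor
  · intro h
    have h_conj : Jᵀ * (a * J + J * aᵀ + Γ) * J = 0 := by rw [h, mul_zero, zero_mul]
    simp only [hJt, mul_add, add_mul, neg_mul, mul_assoc, hJJ, hJJ_mul, mul_neg, mul_one,
      neg_neg] at h_conj
    refine ⟨-(J * a) + (1 / 2 : ℝ) • (J * (Γ * J)), ?_, ?_⟩
    · simp only [transpose_add, transpose_neg, transpose_smul, transpose_mul, hJt, hΓ, neg_mul,
        mul_neg, neg_neg, mul_assoc]
      rw [← sub_eq_zero, ← h_conj]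
      module
    · simp only [mul_add, mul_neg, mul_smul_comm, hJJ_mul, neg_neg, smul_neg]
      abel
  · rintro ⟨R, hR, rfl⟩
    simp only [transpose_add, transpose_smul, transpose_mul, hJt, hΓ, hR, add_mul, mul_add,
      neg_mul, mul_neg, neg_neg, smul_mul_assoc, mul_smul_comm, mul_assoc, hJJ, hJJ_mul, mul_one,
      smul_neg]
    module
end

section
/- Let n be a positive integer. For N ∈ ℝ^{n×n} and a Frechet differentiable function v : ℝ^{n×n} × 𝕊ₙ → ℝ with Frobenius gradients ∂_X v ∈ ℝ^{n×n} and ∂_Y v ∈ 𝕊ₙ, define Λ_N(v)(X,Y) := ⟨N, (1/2) Xᵀ ∂_X v + Y ∂_Y v⟩. Then for any constant matrices N₁, N₂ ∈ ℝ^{n×n} and any twice continuously Frechet differentiable function v : ℝ^{n×n} × 𝕊ₙ → ℝ, the commutation relation Λ_{N₁}(Λ_{N₂}(v)) - Λ_{N₂}(Λ_{N₁}(v)) = Λ_{[N₁,N₂]/2}(v) holds, where [N₁,N₂] := N₁N₂ - N₂N₁. -/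
open Matrix

attribute [local instance] Matrix.frobeniusNormedAddCommGroup Matrix.frobeniusNormedSpace

/-- The subspace `𝕊ₙ` of real symmetric `n × n` matrices. -/
def symMat (n : ℕ) : Submodule ℝ (Matrix (Fin n) (Fin n) ℝ) where
  carrier := {Y | Yᵀ = Y}
  add_mem' := by
    intro a b ha hb
    simp only [Set.mem_setOf_eq] at *
    rw [Matrix.transpose_add, ha, hb]
  zero_mem' := by simp
  smul_mem' := by
    intro c a ha
    simp only [Set.mem_setOf_eq] at *
    rw [Matrix.transpose_smul, ha]

/-- The Frobenius inner product `⟨A, B⟩ = tr(Aᵀ B)`. -/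
noncomputable def frob {n m : ℕ} (A B : Matrix (Fin n) (Fin m) ℝ) : ℝ :=
  (Aᵀ * B).trace

/-- The commutator of the first-order operators given by two linear vector fields `A`, `B` is the
first-order operator given by the linear vector field `B ∘ A - A ∘ B`. -/
lemma hasFDerivAt_linear_field_commutator {E : Type*} [NormedAddCommGroup E] [NormedSpace ℝ E]
    {v : E → ℝ} (hv : ContDiff ℝ 2 v) (A B : E →L[ℝ] E) {p : E} {L₁ L₂ : E →L[ℝ] ℝ}
    (h₁ : HasFDerivAt (fun q => fderiv ℝ v q (A q)) L₁ p)
    (h₂ : HasFDerivAt (fun q => fderiv ℝ v q (B q)) L₂ p) :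
    L₂ (A p) - L₁ (B p) = fderiv ℝ v p (B (A p)) - fderiv ℝ v p (A (B p)) := by
  have hd : HasFDerivAt (fderiv ℝ v) (fderiv ℝ (fderiv ℝ v) p) p :=
    ((hv.fderiv_right (m := 1) (by norm_num)).differentiable (by norm_num) p).hasFDerivAt
  have hsymm : IsSymmSndFDerivAt ℝ v p := hv.contDiffAt.isSymmSndFDerivAt (by simp)
  rw [h₁.unique (hd.clm_apply A.hasFDerivAt), h₂.unique (hd.clm_apply B.hasFDerivAt)]
  have h := hsymm.eq (A p) (B p)
  simp only [_root_.add_apply, ContinuousLinearMap.comp_apply,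
    ContinuousLinearMap.flip_apply]
  linarith

/-- The linear vector field `(X, Y) ↦ (X N / 2, (Y N + Nᵀ Y) / 2)`. -/
noncomputable def linearField {n : ℕ} (N : Matrix (Fin n) (Fin n) ℝ) :
    (Matrix (Fin n) (Fin n) ℝ × symMat n) →ₗ[ℝ] (Matrix (Fin n) (Fin n) ℝ × symMat n) where
  toFun q := ((1 / 2 : ℝ) • (q.1 * N),
    ⟨(1 / 2 : ℝ) • ((q.2 : Matrix (Fin n) (Fin n) ℝ) * N + Nᵀ * q.2), by
      have h : (q.2 : Matrix (Fin n) (Fin n) ℝ)ᵀ = q.2 := q.2.2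
      change _ᵀ = _
      simp [transpose_mul, h, add_comm]⟩)
  map_add' a b := by
    ext i j <;> simp [add_mul, mul_add]; ring
  map_smul' c a := by
    ext i j <;> simp <;> ring

lemma frob_add_eq_frob_linearField {n : ℕ} (N G : Matrix (Fin n) (Fin n) ℝ) (H : symMat n)
    (q : Matrix (Fin n) (Fin n) ℝ × symMat n) :
    frob N ((1 / 2 : ℝ) • (q.1ᵀ * G) + (q.2 : Matrix (Fin n) (Fin n) ℝ) * H) =
      frob G (linearField N q).1 +
        frob (H : Matrix (Fin n) (Fin n) ℝ) ((linearField N q).2 : Matrix (Fin n) (Fin n) ℝ) := by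
  obtain ⟨X, Y, hY⟩ := q
  obtain ⟨H, hH⟩ := H
  change Yᵀ = Y at hY
  change Hᵀ = H at hH
  have e₁ : (Nᵀ * (Xᵀ * G)).trace = (Gᵀ * (X * N)).trace := by
    rw [← trace_transpose]
    simp [transpose_mul, Matrix.mul_assoc]
  have e₂ : (Nᵀ * (Y * H)).trace = (H * (Y * N)).trace := by
    rw [← trace_transpose]
    simp [transpose_mul, Matrix.mul_assoc, hY, hH]
  have e₃ : (H * (Nᵀ * Y)).trace = (Nᵀ * (Y * H)).trace := by
    rw [trace_mul_comm, Matrix.mul_assoc]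
  simp only [frob, linearField, LinearMap.coe_mk, AddHom.coe_mk, mul_add, Matrix.mul_smul,
    trace_add, trace_smul, smul_eq_mul, hH]
  linarith

lemma linearField_commutator {n : ℕ} (N₁ N₂ : Matrix (Fin n) (Fin n) ℝ)
    (q : Matrix (Fin n) (Fin n) ℝ × symMat n) :
    linearField N₂ (linearField N₁ q) - linearField N₁ (linearField N₂ q) =
      linearField ((1 / 2 : ℝ) • (N₁ * N₂ - N₂ * N₁)) q := by
  refine Prod.ext ?_ (Subtype.ext ?_)
  · simp [linearField, mul_sub, Matrix.mul_assoc, smul_sub]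
  · simp only [linearField, LinearMap.coe_mk, AddHom.coe_mk, Prod.snd_sub,
      AddSubgroupClass.coe_sub, mul_add, add_mul, mul_sub, sub_mul, Matrix.mul_smul,
      Matrix.smul_mul, transpose_smul, transpose_sub, transpose_mul, Matrix.mul_assoc]
    module

theorem stmt_6 (n : ℕ) (hn : 0 < n)
    (v : Matrix (Fin n) (Fin n) ℝ × symMat n → ℝ)
    -- v is twice continuously Frechet differentiable
    (hv : ContDiff ℝ 2 v)
    -- Frobenius gradient data (∂_X v, ∂_Y v) for v
    (gX : Matrix (Fin n) (Fin n) ℝ × symMat n → Matrix (Fin n) (Fin n) ℝ)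
    (gY : Matrix (Fin n) (Fin n) ℝ × symMat n → symMat n)
    (Lv : Matrix (Fin n) (Fin n) ℝ × symMat n →
          (Matrix (Fin n) (Fin n) ℝ × symMat n) →L[ℝ] ℝ)
    (hLv : ∀ p, HasFDerivAt v (Lv p) p)
    (hrep : ∀ p δ, Lv p δ = frob (gX p) δ.1 + frob (gY p : Matrix (Fin n) (Fin n) ℝ) (δ.2 : Matrix (Fin n) (Fin n) ℝ))
    (N₁ N₂ : Matrix (Fin n) (Fin n) ℝ)
    (p : Matrix (Fin n) (Fin n) ℝ × symMat n)
    -- Frobenius gradient data for Λ_{N₂}(v) at p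
    (hX₂ : Matrix (Fin n) (Fin n) ℝ) (hY₂ : symMat n)
    (L₂ : (Matrix (Fin n) (Fin n) ℝ × symMat n) →L[ℝ] ℝ)
    (hL₂ : HasFDerivAt
      (fun q : Matrix (Fin n) (Fin n) ℝ × symMat n =>
        frob N₂ ((1 / 2 : ℝ) • (q.1ᵀ * gX q) + (q.2 : Matrix (Fin n) (Fin n) ℝ) * (gY q : Matrix (Fin n) (Fin n) ℝ)))
      L₂ p)
    (hrep₂ : ∀ δ, L₂ δ = frob hX₂ δ.1 + frob (hY₂ : Matrix (Fin n) (Fin n) ℝ) (δ.2 : Matrix (Fin n) (Fin n) ℝ))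
    -- Frobenius gradient data for Λ_{N₁}(v) at p
    (hX₁ : Matrix (Fin n) (Fin n) ℝ) (hY₁ : symMat n)
    (L₁ : (Matrix (Fin n) (Fin n) ℝ × symMat n) →L[ℝ] ℝ)
    (hL₁ : HasFDerivAt
      (fun q : Matrix (Fin n) (Fin n) ℝ × symMat n =>
        frob N₁ ((1 / 2 : ℝ) • (q.1ᵀ * gX q) + (q.2 : Matrix (Fin n) (Fin n) ℝ) * (gY q : Matrix (Fin n) (Fin n) ℝ)))
      L₁ p)
    (hrep₁ : ∀ δ, L₁ δ = frob hX₁ δ.1 + frob (hY₁ : Matrix (Fin n) (Fin n) ℝ) (δ.2 : Matrix (Fin n) (Fin n) ℝ)) :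
    -- the commutation relation Λ_{N₁}(Λ_{N₂}(v)) - Λ_{N₂}(Λ_{N₁}(v)) = Λ_{[N₁,N₂]/2}(v) at p
    frob N₁ ((1 / 2 : ℝ) • (p.1ᵀ * hX₂) + (p.2 : Matrix (Fin n) (Fin n) ℝ) * (hY₂ : Matrix (Fin n) (Fin n) ℝ)) -
      frob N₂ ((1 / 2 : ℝ) • (p.1ᵀ * hX₁) + (p.2 : Matrix (Fin n) (Fin n) ℝ) * (hY₁ : Matrix (Fin n) (Fin n) ℝ)) =
    frob ((1 / 2 : ℝ) • (N₁ * N₂ - N₂ * N₁))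
      ((1 / 2 : ℝ) • (p.1ᵀ * gX p) + (p.2 : Matrix (Fin n) (Fin n) ℝ) * (gY p : Matrix (Fin n) (Fin n) ℝ)) := by
  have hfd : ∀ q, fderiv ℝ v q = Lv q := fun q => (hLv q).fderiv
  have hcont : ∀ N q, frob N ((1 / 2 : ℝ) • (q.1ᵀ * gX q) +
      (q.2 : Matrix (Fin n) (Fin n) ℝ) * (gY q : Matrix (Fin n) (Fin n) ℝ)) =
      fderiv ℝ v q ((linearField N).toContinuousLinearMap q) := fun N q => by
    rw [hfd, hrep, frob_add_eq_frob_linearField]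
    rfl
  simp only [hcont] at hL₁ hL₂ ⊢
  rw [frob_add_eq_frob_linearField, frob_add_eq_frob_linearField, ← hrep₁, ← hrep₂]
  refine (hasFDerivAt_linear_field_commutator hv _ _ hL₁ hL₂).trans ?_
  rw [← map_sub]
  exact congrArg _ (linearField_commutator N₁ N₂ p)
end

section
/- Let p, q be positive integers and α ∈ ℝ^{p×p}, β ∈ ℝ^{q×q} be antisymmetric matrices. Consider the linear operator L : ℝ^{p×q} → ℝ^{p×q}, L(X) := α X β. Then the spectrum (set of real eigenvalues) of L is symmetric about the origin: λ is an eigenvalue of L if and only if -λ is an eigenvalue of L. -/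
open Matrix

/-- Over an algebraically closed field, an endomorphism commuting with `g` has an eigenvector
inside any nonzero eigenspace of `g`. -/
theorem Module.End.exists_common_eigenvector_of_commute {K V : Type*} [Field K] [IsAlgClosed K]
    [AddCommGroup V] [Module K V] [FiniteDimensional K V] {f g : Module.End K V}
    (hfg : Commute g f) {a : K} (ha : ∃ v, v ≠ 0 ∧ g v = a • v) :
    ∃ v, v ≠ 0 ∧ g v = a • v ∧ ∃ b : K, f v = b • v := by
  obtain ⟨v, hv, hgv⟩ := ha
  have hmaps : ∀ w ∈ g.eigenspace a, f w ∈ g.eigenspace a := by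
    intro w hw
    rw [Module.End.mem_eigenspace_iff] at hw ⊢
    have h := LinearMap.congr_fun hfg.eq w
    simp only [Module.End.mul_apply] at h
    rw [h, hw, map_smul]
  have : Nontrivial (g.eigenspace a) :=
    ⟨⟨v, Module.End.mem_eigenspace_iff.2 hgv⟩, 0, fun h => hv (congrArg Subtype.val h)⟩
  obtain ⟨b, hb⟩ := Module.End.exists_eigenvalue (f.restrict hmaps)
  obtain ⟨w, hw⟩ := hb.exists_hasEigenvector
  exact ⟨w, fun h => hw.2 (Subtype.ext h), Module.End.mem_eigenspace_iff.1 w.2, b,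
    congrArg Subtype.val hw.apply_eq_smul⟩

/-- The eigenvalues of an antisymmetric matrix are symmetric about the origin. -/
theorem Matrix.exists_mulVec_eq_neg_smul_of_transpose_eq_neg {K n : Type*} [Field K] [Fintype n]
    [DecidableEq n] {A : Matrix n n K} (hA : Aᵀ = -A) {a : K} {u : n → K} (hu : u ≠ 0)
    (h : A *ᵥ u = a • u) : ∃ w, w ≠ 0 ∧ A *ᵥ w = -a • w := by
  have hdet : (A - scalar n a).det = 0 :=
    exists_mulVec_eq_zero_iff.1 ⟨u, hu, by
      rw [sub_mulVec, h, scalar_apply, ← smul_one_eq_diagonal, smul_mulVec, one_mulVec, sub_self]⟩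
  have htr : (A - scalar n a)ᵀ = -(A + scalar n a) := by
    rw [transpose_sub, hA, scalar_apply, diagonal_transpose]
    abel
  have hdet' : (A + scalar n a).det = 0 := by
    rw [← det_transpose, htr, det_neg] at hdet
    exact (mul_eq_zero.1 hdet).resolve_left (pow_ne_zero _ (neg_ne_zero.2 one_ne_zero))
  obtain ⟨w, hw, hAw⟩ := exists_mulVec_eq_zero_iff.2 hdet'
  refine ⟨w, hw, ?_⟩
  rw [add_mulVec, scalar_apply, ← smul_one_eq_diagonal, smul_mulVec, one_mulVec] at hAw
  rw [neg_smul]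
  exact eq_neg_of_add_eq_zero_left hAw

/-- Over an algebraically closed field, the eigenvalues of `X ↦ A * X * B` are symmetric about the
origin if `A` is antisymmetric. -/
theorem Matrix.exists_mul_mul_eq_neg_smul_of_isAlgClosed {K m n : Type*} [Field K] [IsAlgClosed K]
    [Fintype m] [Fintype n] [DecidableEq m] {A : Matrix m m K} (hA : Aᵀ = -A)
    {B : Matrix n n K} {c : K} {X : Matrix m n K} (hX : X ≠ 0)
    (h : A * X * B = c • X) : ∃ Y : Matrix m n K, Y ≠ 0 ∧ A * Y * B = -c • Y := by
  let f : Module.End K (Matrix m n K) := mulLeftLinearMap n K A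
  let g : Module.End K (Matrix m n K) := mulRightLinearMap m K B ∘ₗ f
  have hfg : Commute g f := LinearMap.ext fun Z => by
    simp [f, g, Matrix.mul_assoc]
  obtain ⟨Z, hZ, hgZ, a, hfZ⟩ :=
    Module.End.exists_common_eigenvector_of_commute hfg ⟨X, hX, h⟩
  replace hgZ : A * Z * B = c • Z := hgZ
  replace hfZ : A * Z = a • Z := hfZ
  obtain ⟨i, j, hij⟩ : ∃ i j, Z i j ≠ 0 := by
    by_contra! H
    exact hZ (Matrix.ext H)
  obtain ⟨w, hw, hAw⟩ := exists_mulVec_eq_neg_smul_of_transpose_eq_neg hA (a := a) (u := Z.col j)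
    (fun H => hij (congrFun H i)) (funext fun k => congrFun (congrFun hfZ k) j)
  have hrow : a • (Z.row i ᵥ* B) = c • Z.row i := by
    rw [hfZ, Matrix.smul_mul] at hgZ
    exact congrFun hgZ i
  obtain ⟨k, hk⟩ := Function.ne_iff.1 hw
  refine ⟨vecMulVec w (Z.row i), fun H => mul_ne_zero hk hij (congrFun (congrFun H k) j), ?_⟩
  rw [mul_vecMulVec, hAw, vecMulVec_mul, smul_vecMulVec, ← vecMulVec_smul, neg_smul, hrow,
    ← neg_smul, vecMulVec_smul]

/-- A real eigenvalue of the complexification of `X ↦ A * X * B` is an eigenvalue of this map. -/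
theorem Matrix.exists_real_mul_mul_eq_smul {m n : Type*} [Fintype m] [Fintype n]
    {A : Matrix m m ℝ} {B : Matrix n n ℝ} {c : ℝ} {Y : Matrix m n ℂ} (hY : Y ≠ 0)
    (h : A.map Complex.ofReal * Y * B.map Complex.ofReal = (c : ℂ) • Y) :
    ∃ X : Matrix m n ℝ, X ≠ 0 ∧ A * X * B = c • X := by
  have hre : A * Y.map Complex.re * B = c • Y.map Complex.re := by
    ext i j
    simpa [Matrix.mul_apply] using congrArg Complex.re (congrFun (congrFun h i) j)
  have him : A * Y.map Complex.im * B = c • Y.map Complex.im := by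
    ext i j
    simpa [Matrix.mul_apply] using congrArg Complex.im (congrFun (congrFun h i) j)
  by_cases h0 : Y.map Complex.re = 0
  · refine ⟨_, fun h1 => hY ?_, him⟩
    ext i j
    exact Complex.ext (congrFun (congrFun h0 i) j) (congrFun (congrFun h1 i) j)
  · exact ⟨_, h0, hre⟩

/-- The real eigenvalues of `X ↦ A * X * B` are symmetric about the origin if `A` is
antisymmetric. -/
theorem Matrix.exists_real_mul_mul_eq_neg_smul {m n : Type*} [Fintype m] [Fintype n]
    [DecidableEq m] {A : Matrix m m ℝ} (hA : Aᵀ = -A) {B : Matrix n n ℝ} {c : ℝ}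
    (h : ∃ X : Matrix m n ℝ, X ≠ 0 ∧ A * X * B = c • X) :
    ∃ X : Matrix m n ℝ, X ≠ 0 ∧ A * X * B = -c • X := by
  obtain ⟨X, hX, hAXB⟩ := h
  have hA' : (A.map Complex.ofReal)ᵀ = -A.map Complex.ofReal := by
    rw [← transpose_map, hA]
    ext i j
    simp
  have hX' : X.map Complex.ofReal ≠ 0 := fun H => hX <| by
    ext i j
    exact Complex.ofReal_eq_zero.1 (congrFun (congrFun H i) j)
  have hAXB' : A.map Complex.ofReal * X.map Complex.ofReal * B.map Complex.ofReal =
      (c : ℂ) • X.map Complex.ofReal := by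
    ext i j
    simpa [Matrix.mul_apply] using congrArg Complex.ofReal (congrFun (congrFun hAXB i) j)
  obtain ⟨Y, hY, hAYB⟩ :=
    exists_mul_mul_eq_neg_smul_of_isAlgClosed hA' hX' hAXB'
  exact exists_real_mul_mul_eq_smul hY (by rwa [Complex.ofReal_neg])

theorem stmt_15 (p q : ℕ) (hp : 0 < p) (hq : 0 < q)
    (α : Matrix (Fin p) (Fin p) ℝ) (hα : αᵀ = -α)
    (β : Matrix (Fin q) (Fin q) ℝ) (hβ : βᵀ = -β)
    (lam : ℝ) :
    (∃ X : Matrix (Fin p) (Fin q) ℝ, X ≠ 0 ∧ α * X * β = lam • X) ↔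
    (∃ X : Matrix (Fin p) (Fin q) ℝ, X ≠ 0 ∧ α * X * β = (-lam) • X) := by
  refine ⟨exists_real_mul_mul_eq_neg_smul hα, fun h => ?_⟩
  simpa only [neg_neg] using exists_real_mul_mul_eq_neg_smul hα h
end
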